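/- Let V_ε(φ) = −(ε/2)φ² + (ε/4)φ⁴ for ε > 0. For every bounded continuous function g : ℝ → ℝ, lim_{ε→∞} (∫_ℝ g(φ) e^{−V_ε(φ)} dφ) / (∫_ℝ e^{−V_ε(φ)} dφ) = (g(1) + g(−1))/2. In particular, in the limit ε → ∞ the Gibbs weight e^{−V_ε} concentrates on the two global minima φ = ±1 of V_ε. -/

import Mathlib

open MeasureTheory Real Filter Topology

/-- The double-well Gibbs weight, normalized to equal `1` at the two minima `±1`. -/
noncomputable def doubleWellWeight (ε x : ℝ) : ℝ := Real.exp (-(ε / 4 * (x ^ 2 - 1) ^ 2))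

lemma continuous_doubleWellWeight (ε : ℝ) : Continuous (doubleWellWeight ε) := by
  unfold doubleWellWeight
  fun_prop

lemma doubleWellWeight_pos (ε x : ℝ) : 0 < doubleWellWeight ε x := Real.exp_pos _

lemma integrable_doubleWellWeight {ε : ℝ} (hε : 0 < ε) : Integrable (doubleWellWeight ε) := by
  have hdom : Integrable fun x : ℝ => Real.exp (5 * ε / 16) * Real.exp (-(ε / 4) * x ^ 2) :=
    (integrable_exp_neg_mul_sq (by positivity)).const_mul _
  refine hdom.mono' (continuous_doubleWellWeight ε).aestronglyMeasurable
    (Eventually.of_forall fun x => ?_)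
  rw [Real.norm_of_nonneg (doubleWellWeight_pos ε x).le, ← Real.exp_add]
  refine Real.exp_le_exp.2 ?_
  nlinarith [mul_nonneg hε.le (sq_nonneg (x ^ 2 - 3 / 2))]

lemma integrable_mul_doubleWellWeight {f : ℝ → ℝ} (hf : Continuous f) {C : ℝ}
    (hC : ∀ x, |f x| ≤ C) {ε : ℝ} (hε : 0 < ε) :
    Integrable fun x => f x * doubleWellWeight ε x :=
  (integrable_doubleWellWeight hε).bdd_mul hf.aestronglyMeasurable (Eventually.of_forall hC)

lemma sq_mul_doubleWellWeight_le {ε : ℝ} (hε : 1 ≤ ε) (x : ℝ) :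
    (x ^ 2 - 1) ^ 2 * doubleWellWeight ε x ≤ 8 / ε * doubleWellWeight (1 / 2) x := by
  have hε' : 0 < ε := by linarith
  set t := (x ^ 2 - 1) ^ 2 with ht
  have ht0 : 0 ≤ t := sq_nonneg _
  have h₁ : t ≤ 8 / ε * Real.exp (ε * t / 8) := by
    have h := Real.add_one_le_exp (ε * t / 8)
    rw [div_mul_eq_mul_div, le_div_iff₀ hε']
    linarith
  calc t * doubleWellWeight ε x
      ≤ 8 / ε * Real.exp (ε * t / 8) * doubleWellWeight ε x :=
        mul_le_mul_of_nonneg_right h₁ (doubleWellWeight_pos ε x).le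
    _ = 8 / ε * Real.exp (ε * t / 8 + -(ε / 4 * t)) := by
        rw [doubleWellWeight, mul_assoc, ← Real.exp_add]
    _ ≤ 8 / ε * doubleWellWeight (1 / 2) x := by
        refine mul_le_mul_of_nonneg_left (Real.exp_le_exp.2 ?_) (by positivity)
        nlinarith [mul_nonneg (sub_nonneg.2 hε) ht0]

lemma integrable_sq_mul_doubleWellWeight {ε : ℝ} (hε : 1 ≤ ε) :
    Integrable fun x : ℝ => (x ^ 2 - 1) ^ 2 * doubleWellWeight ε x := by
  refine ((integrable_doubleWellWeight (ε := 1 / 2) (by norm_num)).const_mul (8 / ε)).mono'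
    (Continuous.aestronglyMeasurable ?_) (Eventually.of_forall fun x => ?_)
  · exact Continuous.mul (by fun_prop) (continuous_doubleWellWeight ε)
  · rw [Real.norm_of_nonneg (mul_nonneg (sq_nonneg _) (doubleWellWeight_pos ε x).le)]
    exact sq_mul_doubleWellWeight_le hε x

lemma integral_sq_mul_doubleWellWeight_le {ε : ℝ} (hε : 1 ≤ ε) :
    ∫ x, (x ^ 2 - 1) ^ 2 * doubleWellWeight ε x ≤ 8 / ε * ∫ x, doubleWellWeight (1 / 2) x := by
  rw [← integral_const_mul]
  exact integral_mono (integrable_sq_mul_doubleWellWeight hε)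
    ((integrable_doubleWellWeight (by norm_num)).const_mul _) (sq_mul_doubleWellWeight_le hε)

lemma exp_div_sqrt_le_integral_doubleWellWeight {ε : ℝ} (hε : 1 ≤ ε) :
    Real.exp (-(9 / 4)) / √ε ≤ ∫ x, doubleWellWeight ε x := by
  have hε' : 0 < ε := by linarith
  have hs : 0 < √ε := Real.sqrt_pos.2 hε'
  have hs1 : (√ε)⁻¹ ≤ 1 := inv_le_one_of_one_le₀ (Real.one_le_sqrt.2 hε)
  have hsq : ε * (√ε)⁻¹ ^ 2 = 1 := by
    rw [inv_pow, Real.sq_sqrt hε'.le, mul_inv_cancel₀ hε'.ne']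
  have hpos : 0 < (√ε)⁻¹ := inv_pos.2 hs
  set s := (√ε)⁻¹ with hs_def
  have hlow : ∀ x ∈ Set.Icc 1 (1 + s), Real.exp (-(9 / 4)) ≤ doubleWellWeight ε x := by
    rintro x ⟨h1, h2⟩
    refine Real.exp_le_exp.2 ?_
    have h3 : (x ^ 2 - 1) ^ 2 ≤ (3 * s) ^ 2 := by
      refine pow_le_pow_left₀ (by nlinarith) ?_ 2
      nlinarith
    nlinarith [mul_le_mul_of_nonneg_left h3 hε'.le]
  calc Real.exp (-(9 / 4)) / √ε = ∫ _ in Set.Icc 1 (1 + s), Real.exp (-(9 / 4)) := by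
        simp [div_eq_mul_inv, hpos.le, mul_comm, ← hs_def]
    _ ≤ ∫ x in Set.Icc 1 (1 + s), doubleWellWeight ε x :=
        setIntegral_mono_on (by simp) (integrable_doubleWellWeight hε').integrableOn
          measurableSet_Icc hlow
    _ ≤ ∫ x, doubleWellWeight ε x :=
        setIntegral_le_integral (integrable_doubleWellWeight hε')
          (Eventually.of_forall fun x => (doubleWellWeight_pos ε x).le)

lemma integral_doubleWellWeight_pos {ε : ℝ} (hε : 1 ≤ ε) : 0 < ∫ x, doubleWellWeight ε x :=
  lt_of_lt_of_le (div_pos (Real.exp_pos _) (Real.sqrt_pos.2 (by linarith)))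
    (exp_div_sqrt_le_integral_doubleWellWeight hε)

lemma tendsto_integral_sq_mul_doubleWellWeight_div :
    Tendsto (fun ε : ℝ => (∫ x, (x ^ 2 - 1) ^ 2 * doubleWellWeight ε x) /
      ∫ x, doubleWellWeight ε x) atTop (𝓝 0) := by
  set A := ∫ x, doubleWellWeight (1 / 2) x
  have hA0 : 0 ≤ A := integral_nonneg fun x => (doubleWellWeight_pos _ x).le
  have hlim : Tendsto (fun ε : ℝ => 8 * A / Real.exp (-(9 / 4)) / √ε) atTop (𝓝 0) :=
    Real.tendsto_sqrt_atTop.const_div_atTop _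
  refine tendsto_of_tendsto_of_tendsto_of_le_of_le' tendsto_const_nhds hlim ?_ ?_
  · exact Eventually.of_forall fun ε => div_nonneg
      (integral_nonneg fun x => mul_nonneg (sq_nonneg _) (doubleWellWeight_pos ε x).le)
      (integral_nonneg fun x => (doubleWellWeight_pos ε x).le)
  · filter_upwards [eventually_ge_atTop 1] with ε hε
    have hε' : 0 < ε := by linarith
    have hs : 0 < √ε := Real.sqrt_pos.2 hε'
    calc _ ≤ (8 / ε * A) / (Real.exp (-(9 / 4)) / √ε) :=
          div_le_div₀ (by positivity) (integral_sq_mul_doubleWellWeight_le hε)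
            (div_pos (Real.exp_pos _) hs) (exp_div_sqrt_le_integral_doubleWellWeight hε)
      _ = 8 * A / Real.exp (-(9 / 4)) / √ε := by
          have he := (Real.exp_pos (-(9 / 4))).ne'
          field_simp
          rw [Real.sq_sqrt hε'.le, mul_comm]

/-- A bounded continuous function vanishing at `±1` is, up to an arbitrarily small constant,
dominated by a multiple of `(x ^ 2 - 1) ^ 2`. -/
lemma exists_abs_le_add_mul_sq {f : ℝ → ℝ} (hf : Continuous f) {C : ℝ} (hC : ∀ x, |f x| ≤ C)
    (h1 : f 1 = 0) (h2 : f (-1) = 0) {δ : ℝ} (hδ : 0 < δ) :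
    ∃ K, 0 ≤ K ∧ ∀ x, |f x| ≤ δ + K * (x ^ 2 - 1) ^ 2 := by
  obtain ⟨r₁, hr₁, hf₁⟩ := Metric.continuous_iff.1 hf 1 δ hδ
  obtain ⟨r₂, hr₂, hf₂⟩ := Metric.continuous_iff.1 hf (-1) δ hδ
  simp only [Real.dist_eq, h1, h2, sub_zero, sub_neg_eq_add] at hf₁ hf₂
  have hC0 : 0 ≤ C := (abs_nonneg _).trans (hC 0)
  refine ⟨C / (r₁ * r₂) ^ 2, by positivity, fun x => ?_⟩
  have hnn : 0 ≤ C / (r₁ * r₂) ^ 2 * (x ^ 2 - 1) ^ 2 := by positivity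
  by_cases hx₁ : |x - 1| < r₁
  · linarith [hf₁ x hx₁]
  by_cases hx₂ : |x + 1| < r₂
  · linarith [hf₂ x hx₂]
  have hle : (r₁ * r₂) ^ 2 ≤ (x ^ 2 - 1) ^ 2 := by
    rw [show x ^ 2 - 1 = (x - 1) * (x + 1) by ring, ← sq_abs ((x - 1) * (x + 1)), abs_mul]
    have := not_lt.1 hx₁
    have := not_lt.1 hx₂
    gcongr
  have : C ≤ C / (r₁ * r₂) ^ 2 * (x ^ 2 - 1) ^ 2 := by
    rw [div_mul_eq_mul_div, le_div_iff₀ (by positivity)]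
    exact mul_le_mul_of_nonneg_left hle hC0
  linarith [hC x]

lemma tendsto_integral_mul_doubleWellWeight_div_of_eq_zero {f : ℝ → ℝ} (hf : Continuous f)
    {C : ℝ} (hC : ∀ x, |f x| ≤ C) (h1 : f 1 = 0) (h2 : f (-1) = 0) :
    Tendsto (fun ε : ℝ => (∫ x, f x * doubleWellWeight ε x) / ∫ x, doubleWellWeight ε x)
      atTop (𝓝 0) := by
  refine Metric.tendsto_nhds.2 fun η hη => ?_
  obtain ⟨K, hK, hfK⟩ := exists_abs_le_add_mul_sq hf hC h1 h2 (half_pos hη)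
  have hsmall := tendsto_integral_sq_mul_doubleWellWeight_div.const_mul K
  rw [mul_zero] at hsmall
  filter_upwards [eventually_ge_atTop 1, hsmall.eventually_lt_const (half_pos hη)] with ε hε hlt
  have hε' : 0 < ε := by linarith
  have hZ := integral_doubleWellWeight_pos hε
  have hint := integrable_doubleWellWeight hε'
  have hint₂ := integrable_sq_mul_doubleWellWeight hε
  have hbound : |∫ x, f x * doubleWellWeight ε x| ≤
      η / 2 * (∫ x, doubleWellWeight ε x) +
        K * ∫ x, (x ^ 2 - 1) ^ 2 * doubleWellWeight ε x := by
    rw [← integral_const_mul, ← integral_const_mul,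
      ← integral_add (hint.const_mul _) (hint₂.const_mul _), ← Real.norm_eq_abs]
    refine norm_integral_le_of_norm_le ((hint.const_mul _).add (hint₂.const_mul _))
      (Eventually.of_forall fun x => ?_)
    rw [norm_mul, Real.norm_of_nonneg (doubleWellWeight_pos ε x).le, Real.norm_eq_abs,
      ← mul_assoc, ← add_mul]
    exact mul_le_mul_of_nonneg_right (hfK x) (doubleWellWeight_pos ε x).le
  rw [mul_div_assoc', div_lt_iff₀ hZ] at hlt
  rw [Real.dist_eq, sub_zero, abs_div, abs_of_pos hZ, div_lt_iff₀ hZ]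
  linarith

lemma integral_comp_neg_mul_doubleWellWeight (g : ℝ → ℝ) (ε : ℝ) :
    ∫ x, g (-x) * doubleWellWeight ε x = ∫ x, g x * doubleWellWeight ε x := by
  rw [← integral_neg_eq_self fun x => g x * doubleWellWeight ε x]
  simp [doubleWellWeight]

lemma exp_neg_doubleWell_eq (ε x : ℝ) :
    Real.exp (-(-(ε / 2) * x ^ 2 + (ε / 4) * x ^ 4)) =
      Real.exp (ε / 4) * doubleWellWeight ε x := by
  rw [doubleWellWeight, ← Real.exp_add]
  ring_nf

/-- **Concentration of the Gibbs weight on the double-well minima.** Let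
`V_ε(φ) = −(ε/2)φ² + (ε/4)φ⁴`. For every bounded continuous `g : ℝ → ℝ`,
`lim_{ε→∞} (∫ g(φ) e^{−V_ε(φ)} dφ) / (∫ e^{−V_ε(φ)} dφ) = (g(1) + g(−1))/2`. -/
theorem gibbs_double_well_concentration (g : ℝ → ℝ) (hg : Continuous g)
    (hb : ∃ C, ∀ x, |g x| ≤ C) :
    Tendsto
      (fun ε : ℝ =>
        (∫ φ : ℝ, g φ * Real.exp (-(-(ε / 2) * φ ^ 2 + (ε / 4) * φ ^ 4))) /
          (∫ φ : ℝ, Real.exp (-(-(ε / 2) * φ ^ 2 + (ε / 4) * φ ^ 4))))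
      atTop (𝓝 ((g 1 + g (-1)) / 2)) := by
  obtain ⟨C, hC⟩ := hb
  set a := (g 1 + g (-1)) / 2 with ha
  have hcont : Continuous fun x => (g x + g (-x)) / 2 - a := by fun_prop
  have hbdd : ∀ x, |(g x + g (-x)) / 2 - a| ≤ 2 * C := fun x => by
    have h₁ := abs_le.1 (hC x)
    have h₂ := abs_le.1 (hC (-x))
    have h₃ := abs_le.1 (hC 1)
    have h₄ := abs_le.1 (hC (-1))
    rw [abs_le]
    constructor <;> linarith
  have hlim := (tendsto_integral_mul_doubleWellWeight_div_of_eq_zero hcont hbdd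
    (by simp [ha]) (by simp [ha, add_comm])).add_const a
  rw [zero_add] at hlim
  refine hlim.congr' ?_
  filter_upwards [eventually_ge_atTop 1] with ε hε
  have hε' : 0 < ε := by linarith
  have hZ := (integral_doubleWellWeight_pos hε).ne'
  have hi := integrable_mul_doubleWellWeight hg hC hε'
  have hi' := integrable_mul_doubleWellWeight (f := fun x => g (-x)) (by fun_prop)
    (fun x => hC (-x)) hε'
  have hsplit : ∫ x, ((g x + g (-x)) / 2 - a) * doubleWellWeight ε x =
      (∫ x, g x * doubleWellWeight ε x) - a * ∫ x, doubleWellWeight ε x := by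
    calc _ = ∫ x, ((1 / 2) * (g x * doubleWellWeight ε x + g (-x) * doubleWellWeight ε x) -
            a * doubleWellWeight ε x) := by
          congr 1 with x
          ring
      _ = _ := by
          have hsum : Integrable fun x =>
              g x * doubleWellWeight ε x + g (-x) * doubleWellWeight ε x := hi.add hi'
          rw [integral_sub (hsum.const_mul _)
            ((integrable_doubleWellWeight hε').const_mul _), integral_const_mul,
            integral_const_mul, integral_add hi hi', integral_comp_neg_mul_doubleWellWeight]
          ring
  simp only [exp_neg_doubleWell_eq, mul_left_comm (g _), integral_const_mul]
  rw [hsplit, mul_div_mul_left _ _ (Real.exp_pos _).ne']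
  field_simp
  ring
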